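/- arXiv:2503.12915 — 7 statements merged into one kernel-verified Lean document; each statement's English description precedes it below -/
import Mathlib

section
/- For every k ≥ 0: 1/2 + sqrt(L_{k+1} μ_k / (L_k μ_{k+1})) · t_k ≤ t_{k+1} ≤ (1 + sqrt(L_{k+1} μ_k / (L_k μ_{k+1}))) · t_k. -/
/-- for the sequence `t` defined by `t 0 = 1` and
`t (k+1) = (1 + √(1 + 4 (μ k L (k+1) / (μ (k+1) L k)) (t k)²)) / 2`, one has
`1/2 + √(L (k+1) μ k / (L k μ (k+1))) ⬝ t k ≤ t (k+1) ≤ (1 + √(L (k+1) μ k / (L k μ (k+1)))) ⬝ t k`. -/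
theorem stmt_3 (μ L t : ℕ → ℝ) (hμ : ∀ k, 0 < μ k) (hL : ∀ k, 0 < L k)
    (ht0 : t 0 = 1)
    (htrec : ∀ k, t (k + 1) =
      (1 + Real.sqrt (1 + 4 * (μ k * L (k + 1) / (μ (k + 1) * L k)) * (t k) ^ 2)) / 2) :
    ∀ k, 1 / 2 + Real.sqrt (L (k + 1) * μ k / (L k * μ (k + 1))) * t k ≤ t (k + 1) ∧
      t (k + 1) ≤ (1 + Real.sqrt (L (k + 1) * μ k / (L k * μ (k + 1)))) * t k := by
  have h1 : ∀ k, 1 ≤ t k := by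
    intro k
    cases k with
    | zero => rw [ht0]
    | succ n =>
      have hq : 0 < μ n * L (n + 1) / (μ (n + 1) * L n) :=
        div_pos (mul_pos (hμ _) (hL _)) (mul_pos (hμ _) (hL _))
      have : 1 ≤ Real.sqrt (1 + 4 * (μ n * L (n + 1) / (μ (n + 1) * L n)) * (t n) ^ 2) := by
        rw [Real.one_le_sqrt]
        have := mul_nonneg hq.le (sq_nonneg (t n))
        linarith
      rw [htrec n]
      linarith
  intro k
  have hk := h1 k
  have hq : 0 < L (k + 1) * μ k / (L k * μ (k + 1)) :=
    div_pos (mul_pos (hL _) (hμ _)) (mul_pos (hL _) (hμ _))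
  rw [htrec k, mul_comm (μ k) (L (k + 1)), mul_comm (μ (k + 1)) (L k)]
  generalize L (k + 1) * μ k / (L k * μ (k + 1)) = q at hq
  have hs := Real.sq_sqrt hq.le
  have hs0 := Real.sqrt_nonneg q
  generalize Real.sqrt q = s at hs hs0
  subst hs
  have hst : 0 ≤ s * t k := mul_nonneg hs0 (by linarith)
  constructor
  · have : 2 * (s * t k) ≤ Real.sqrt (1 + 4 * s ^ 2 * t k ^ 2) := by
      apply Real.le_sqrt_of_sq_le
      nlinarith
    linarith
  · have : Real.sqrt (1 + 4 * s ^ 2 * t k ^ 2) ≤ 1 + 2 * (s * t k) := by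
      apply Real.sqrt_le_iff.2 ⟨by linarith, by nlinarith⟩
    linarith
end

section
/- For every k ≥ 0: t_{k+1} · sqrt(μ_{k+1} / L_{k+1}) ≤ (4 sqrt(μ_0 / L_0) / (2 − σ)) · (k+2)^{1 − σ/2}. -/
/-- with `μ₀ ∈ (0,1]`, `σ ∈ (0,2)`, `μ k = μ₀ / k^σ` for `k ≥ 1`,
and `L k ≥ L 0 ≥ 1`, the sequence `t` satisfies
`t (k+1) √(μ (k+1) / L (k+1)) ≤ (4 √(μ₀ / L 0) / (2 − σ)) (k+2)^{1 − σ/2}`. -/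
theorem stmt_5 (μ L t : ℕ → ℝ) (σ : ℝ) (hL : ∀ k, 0 < L k)
    (hμ0 : 0 < μ 0 ∧ μ 0 ≤ 1) (hσ : 0 < σ ∧ σ < 2)
    (hμ : ∀ k : ℕ, 1 ≤ k → μ k = μ 0 / (k : ℝ) ^ σ)
    (hL0 : 1 ≤ L 0) (hLk : ∀ k, L 0 ≤ L k)
    (ht0 : t 0 = 1)
    (htrec : ∀ k, t (k + 1) =
      (1 + Real.sqrt (1 + 4 * (μ k * L (k + 1) / (μ (k + 1) * L k)) * (t k) ^ 2)) / 2) :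
    ∀ k : ℕ, t (k + 1) * Real.sqrt (μ (k + 1) / L (k + 1)) ≤
      4 * Real.sqrt (μ 0 / L 0) / (2 - σ) * ((k : ℝ) + 2) ^ (1 - σ / 2) := by
  obtain ⟨hm0, hm1⟩ := hμ0
  obtain ⟨hσ0, hσ2⟩ := hσ
  set q : ℝ := 1 - σ / 2 with hq
  have hq0 : 0 < q := by rw [hq]; linarith
  have hq1 : q ≤ 1 := by rw [hq]; linarith
  have hμp : ∀ k, 0 < μ k := by
    intro k
    rcases Nat.eq_zero_or_pos k with h | h
    · rw [h]; exact hm0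
    · rw [hμ k h]
      have : (0:ℝ) < k := by exact_mod_cast h
      positivity
  set S := Real.sqrt (μ 0 / L 0) with hS
  have hS0 : 0 ≤ S := Real.sqrt_nonneg _
  have htp : ∀ k, 0 ≤ t k := by
    intro k
    cases k with
    | zero => rw [ht0]; norm_num
    | succ k => rw [htrec k]; positivity
  have hstep : ∀ k, t (k+1) * Real.sqrt (μ (k+1) / L (k+1)) ≤
      Real.sqrt (μ (k+1) / L (k+1)) + t k * Real.sqrt (μ k / L k) := by
    intro k
    have h1 := hμp k
    have h2 := hμp (k+1)
    have h3 := hL k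
    have h4 := hL (k+1)
    have h5 := htp k
    set b := Real.sqrt (μ (k+1) / L (k+1)) with hb
    set a := Real.sqrt (μ k / L k) with ha
    have hb0 : 0 < b := Real.sqrt_pos.mpr (by positivity)
    have ha0 : 0 < a := Real.sqrt_pos.mpr (by positivity)
    have hb2 : b ^ 2 = μ (k+1) / L (k+1) := Real.sq_sqrt (by positivity)
    have ha2 : a ^ 2 = μ k / L k := Real.sq_sqrt (by positivity)
    have hr : μ k * L (k + 1) / (μ (k + 1) * L k) = a ^ 2 / b ^ 2 := by
      rw [ha2, hb2]; field_simp
    have hs : Real.sqrt (1 + 4 * (a ^ 2 / b ^ 2) * (t k) ^ 2) ≤ 1 + 2 * (a / b * t k) := by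
      apply Real.sqrt_le_iff.mpr
      have h0 : 0 ≤ a / b * t k := by positivity
      refine ⟨by linarith, ?_⟩
      rw [← div_pow]
      nlinarith
    rw [htrec k, hr]
    calc _ ≤ (1 + (1 + 2 * (a / b * t k))) / 2 * b := by gcongr
      _ = b + t k * a := by field_simp; ring
  have hsb : ∀ k : ℕ, Real.sqrt (μ (k+1) / L (k+1)) ≤ S * ((k:ℝ)+1) ^ (q - 1) := by
    intro k
    have hk : (0:ℝ) < (k:ℝ) + 1 := by positivity
    have h1 : ((k:ℝ)+1) ^ (q-1) = Real.sqrt (((k:ℝ)+1) ^ (-σ)) := by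
      rw [Real.sqrt_eq_rpow, ← Real.rpow_mul hk.le]
      congr 1
      rw [hq]; ring
    have hL00 := hL 0
    rw [h1, hS, ← Real.sqrt_mul (by positivity)]
    apply Real.sqrt_le_sqrt
    rw [hμ (k+1) (by omega), Real.rpow_neg hk.le]
    push_cast
    have : μ 0 / L 0 * (((k:ℝ)+1) ^ σ)⁻¹ = μ 0 / ((k:ℝ)+1) ^ σ / L 0 := by
      field_simp
    rw [this]
    exact div_le_div_of_nonneg_left (by positivity) hL00 (hLk _)
  have hbern : ∀ k : ℕ, ((k:ℝ)+1) ^ (q-1) + (k:ℝ) ^ q / q ≤ ((k:ℝ)+1) ^ q / q := by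
    intro k
    have hk : (0:ℝ) < (k:ℝ) + 1 := by positivity
    have hinv : 1 / ((k:ℝ)+1) ≤ 1 := by
      rw [div_le_one hk]; have : (0:ℝ) ≤ k := by positivity
      linarith
    have hB := rpow_one_add_le_one_add_mul_self (s := -(1 / ((k:ℝ)+1))) (by linarith) hq0.le hq1
    have e1 : 1 + -(1 / ((k:ℝ)+1)) = k / ((k:ℝ)+1) := by field_simp; ring
    rw [e1, Real.div_rpow (by positivity) hk.le, div_le_iff₀ (by positivity)] at hB
    have e2 : ((k:ℝ)+1) ^ (q-1) = ((k:ℝ)+1) ^ q / ((k:ℝ)+1) := by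
      rw [Real.rpow_sub hk, Real.rpow_one]
    have e3 : ((k:ℝ)+1) ^ (q-1) + (k:ℝ) ^ q / q = (q * (((k:ℝ)+1) ^ q / ((k:ℝ)+1)) + (k:ℝ) ^ q) / q := by
      rw [e2]; field_simp
    rw [e3]
    apply div_le_div_of_nonneg_right _ hq0.le
    have e4 : (1 + q * -(1 / ((k:ℝ)+1))) * ((k:ℝ)+1) ^ q =
      ((k:ℝ)+1) ^ q - q * (((k:ℝ)+1) ^ q / ((k:ℝ)+1)) := by ring
    linarith
  have hind : ∀ k : ℕ, t k * Real.sqrt (μ k / L k) ≤ S * (1 + (k:ℝ) ^ q / q) := by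
    intro k
    induction k with
    | zero =>
      rw [ht0, Nat.cast_zero, Real.zero_rpow hq0.ne']
      simp [hS]
    | succ k ih =>
      have h1 := hstep k
      have h2 := hsb k
      have h3 := mul_le_mul_of_nonneg_left (hbern k) hS0
      push_cast
      linarith
  intro k
  refine (hind (k+1)).trans ?_
  have e : 4 * S / (2 - σ) * ((k:ℝ)+2) ^ q = S * (((k:ℝ)+2) ^ q / q + ((k:ℝ)+2) ^ q / q) := by
    have : 2 - σ = 2 * q := by rw [hq]; ring
    rw [this]; field_simp; ring
  rw [e]
  apply mul_le_mul_of_nonneg_left _ hS0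
  have hk0 : (0:ℝ) ≤ k := by positivity
  have h1 : (1:ℝ) ≤ ((k:ℝ)+2) ^ q := Real.one_le_rpow (by linarith) hq0.le
  apply add_le_add
  · rw [le_div_iff₀ hq0]; linarith
  · push_cast
    apply div_le_div_of_nonneg_right _ hq0.le
    exact Real.rpow_le_rpow (by linarith) (by linarith) hq0.le
end

section
/- For every k ≥ 0: L_{k+1}^{−1} t_{k+1} μ_{k+1}² ≤ (4 μ_0² / (L_0 (2 − σ))) · (k+1)^{1 − 2σ}. -/
/-- with `μ₀ ∈ (0,1]`, `σ ∈ (0,2)`, `μ k = μ₀ / k^σ` for `k ≥ 1`,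
and `L k ≥ L 0 ≥ 1`, the sequence `t` satisfies
`L (k+1)⁻¹ t (k+1) μ (k+1)² ≤ (4 μ₀² / (L 0 (2 − σ))) (k+1)^{1 − 2σ}`. -/
theorem stmt_7 (μ L t : ℕ → ℝ) (σ : ℝ) (hL : ∀ k, 0 < L k)
    (hμ0 : 0 < μ 0 ∧ μ 0 ≤ 1) (hσ : 0 < σ ∧ σ < 2)
    (hμ : ∀ k : ℕ, 1 ≤ k → μ k = μ 0 / (k : ℝ) ^ σ)
    (hL0 : 1 ≤ L 0) (hLk : ∀ k, L 0 ≤ L k)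
    (ht0 : t 0 = 1)
    (htrec : ∀ k, t (k + 1) =
      (1 + Real.sqrt (1 + 4 * (μ k * L (k + 1) / (μ (k + 1) * L k)) * (t k) ^ 2)) / 2) :
    ∀ k : ℕ, (L (k + 1))⁻¹ * t (k + 1) * (μ (k + 1)) ^ 2 ≤
      4 * (μ 0) ^ 2 / (L 0 * (2 - σ)) * ((k : ℝ) + 1) ^ (1 - 2 * σ) := by
  obtain ⟨hm0, -⟩ := hμ0
  obtain ⟨hs0, hs2⟩ := hσ
  obtain ⟨a, rfl⟩ : ∃ a, σ = 2 * a := ⟨σ / 2, by ring⟩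
  have ha0 : 0 < a := by linarith
  have ha1 : 0 < 1 - a := by linarith
  obtain ⟨R, hR⟩ : ∃ R : ℕ → ℝ, ∀ k, 0 < R k ∧ L k = R k ^ 2 :=
    ⟨fun k => Real.sqrt (L k), fun k => ⟨Real.sqrt_pos.2 (hL k), (Real.sq_sqrt (hL k).le).symm⟩⟩
  have hRk : ∀ k, R 0 ≤ R k := by
    intro k
    have h := hLk k
    rw [(hR k).2, (hR 0).2] at h
    exact (sq_le_sq₀ (hR 0).1.le (hR k).1.le).1 h
  have hR0 := (hR 0).1
  have hpow : ∀ x : ℝ, 0 < x → x ^ (2 * a) = (x ^ a) ^ 2 := by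
    intro x hx
    rw [mul_comm, Real.rpow_mul hx.le]
    norm_cast
  have key : ∀ p u : ℝ, 0 ≤ p → 0 ≤ u →
      0 ≤ (1 + Real.sqrt (1 + 4 * p ^ 2 * u ^ 2)) / 2 ∧
      (1 + Real.sqrt (1 + 4 * p ^ 2 * u ^ 2)) / 2 ≤ 1 + p * u := by
    intro p u hp hu
    have h1 := Real.sqrt_nonneg (1 + 4 * p ^ 2 * u ^ 2)
    have h2 : Real.sqrt (1 + 4 * p ^ 2 * u ^ 2) ≤ 1 + 2 * (p * u) := by
      have := mul_nonneg hp hu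
      apply Real.sqrt_le_iff.2
      constructor
      · linarith
      · nlinarith
    constructor <;> linarith
  have main : ∀ n : ℕ, 0 ≤ t (n + 1) ∧
      t (n + 1) * R 0 ≤ R (n + 1) * (((n : ℝ) + 1) ^ a + ((n : ℝ) + 1) / (1 - a)) := by
    intro n
    induction n with
    | zero =>
      have hc : μ 0 * L (0 + 1) / (μ (0 + 1) * L 0) = (R 1 / R 0) ^ 2 := by
        rw [hμ (0 + 1) le_rfl, (hR 0).2, (hR (0 + 1)).2]
        simp
        field_simp
      obtain ⟨h1, h2⟩ := key (R 1 / R 0) (t 0) (div_nonneg (hR 1).1.le hR0.le) (by simp [ht0])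
      rw [← hc, ← htrec 0] at h1 h2
      refine ⟨h1, ?_⟩
      have h3 : 1 ≤ 1 / (1 - a) := by rw [le_div_iff₀ ha1]; linarith
      have h4 := mul_le_mul_of_nonneg_right h2 hR0.le
      rw [ht0] at h4
      have h5 : (1 + R 1 / R 0 * 1) * R 0 = R 0 + R 1 := by field_simp
      rw [h5] at h4
      simp only [Nat.cast_zero, zero_add, Real.one_rpow] at h4 ⊢
      nlinarith [hRk 1, (hR 1).1]
    | succ n ih =>
      obtain ⟨ih0, ih⟩ := ih
      have hx : (0 : ℝ) < (n : ℝ) + 1 := by positivity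
      have hy : (0 : ℝ) < (n : ℝ) + 1 + 1 := by positivity
      push_cast
      have hμ1 := hμ (n + 1) (by omega)
      have hμ2 := hμ (n + 1 + 1) (by omega)
      push_cast at hμ1 hμ2
      rw [hpow _ hx] at hμ1
      rw [hpow _ hy] at hμ2
      have am := Real.geom_mean_le_arith_mean2_weighted ha0.le ha1.le hy.le hx.le (by ring)
      rw [Real.rpow_sub hx, Real.rpow_one] at am
      have hX := Real.rpow_pos_of_pos hx a
      have hY := Real.rpow_pos_of_pos hy a
      generalize ((n : ℝ) + 1) ^ a = X at *
      generalize ((n : ℝ) + 1 + 1) ^ a = Y at *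
      have hr1 := (hR (n + 1)).1
      have hr2 := (hR (n + 1 + 1)).1
      have hc : μ (n + 1) * L (n + 1 + 1) / (μ (n + 1 + 1) * L (n + 1))
          = (R (n + 1 + 1) / R (n + 1) * (Y / X)) ^ 2 := by
        rw [hμ1, hμ2, (hR (n + 1)).2, (hR (n + 1 + 1)).2]
        field_simp
      obtain ⟨h1, h2⟩ := key (R (n + 1 + 1) / R (n + 1) * (Y / X)) (t (n + 1))
        (by positivity) ih0
      rw [← hc, ← htrec (n + 1)] at h1 h2
      refine ⟨h1, ?_⟩
      calc t (n + 1 + 1) * R 0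
          ≤ (1 + R (n + 1 + 1) / R (n + 1) * (Y / X) * t (n + 1)) * R 0 :=
            mul_le_mul_of_nonneg_right h2 hR0.le
        _ = R 0 + R (n + 1 + 1) / R (n + 1) * (Y / X) * (t (n + 1) * R 0) := by ring
        _ ≤ R (n + 1 + 1) + R (n + 1 + 1) / R (n + 1) * (Y / X) *
            (R (n + 1) * (X + ((n : ℝ) + 1) / (1 - a))) :=
            add_le_add (hRk _) (mul_le_mul_of_nonneg_left ih (by positivity))
        _ = R (n + 1 + 1) * (Y + (1 + Y * (((n : ℝ) + 1) / X) / (1 - a))) := by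
            field_simp
            ring
        _ ≤ R (n + 1 + 1) * (Y + ((n : ℝ) + 1 + 1) / (1 - a)) := by
            apply mul_le_mul_of_nonneg_left _ hr2.le
            have : 1 + Y * (((n : ℝ) + 1) / X) / (1 - a)
                = ((1 - a) + Y * (((n : ℝ) + 1) / X)) / (1 - a) := by
              field_simp
            rw [this]
            have := div_le_div_of_nonneg_right (c := 1 - a)
              (show (1 - a) + Y * (((n : ℝ) + 1) / X) ≤ (n : ℝ) + 1 + 1 by linarith) ha1.le
            linarith
  intro k
  obtain ⟨h0, h⟩ := main k
  have hx : (0 : ℝ) < (k : ℝ) + 1 := by positivity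
  have hμ1 := hμ (k + 1) (by omega)
  push_cast at hμ1
  have hXx : ((k : ℝ) + 1) ^ a ≤ (k : ℝ) + 1 := by
    have := Real.rpow_le_rpow_of_exponent_le (x := (k : ℝ) + 1) (by simp)
      (show a ≤ 1 by linarith)
    simpa using this
  have hr := (hR (k + 1)).1
  have e : ((k : ℝ) + 1) ^ (1 - 2 * (2 * a)) = ((k : ℝ) + 1) / (((k : ℝ) + 1) ^ (2 * a)) ^ 2 := by
    rw [Real.rpow_sub hx, Real.rpow_one, mul_comm 2 (2 * a), Real.rpow_mul hx.le]
    norm_cast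
  have hZ := Real.rpow_pos_of_pos hx (2 * a)
  rw [e, hμ1]
  have h3 : t (k + 1) * R 0 ^ 2 ≤ R (k + 1) ^ 2 * (2 * ((k : ℝ) + 1) / (1 - a)) := by
    have h4 : ((k : ℝ) + 1) ^ a + ((k : ℝ) + 1) / (1 - a) ≤ 2 * ((k : ℝ) + 1) / (1 - a) := by
      have : (k : ℝ) + 1 ≤ ((k : ℝ) + 1) / (1 - a) := by
        rw [le_div_iff₀ ha1]; nlinarith
      rw [mul_div_assoc]; linarith
    calc t (k + 1) * R 0 ^ 2 = (t (k + 1) * R 0) * R 0 := by ring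
      _ ≤ (R (k + 1) * (2 * ((k : ℝ) + 1) / (1 - a))) * R (k + 1) :=
        mul_le_mul (h.trans (mul_le_mul_of_nonneg_left h4 hr.le)) (hRk _) hR0.le (by positivity)
      _ = _ := by ring
  have h5 : (L (k + 1))⁻¹ * t (k + 1) ≤ 2 * ((k : ℝ) + 1) / (1 - a) / L 0 := by
    rw [(hR 0).2, (hR (k + 1)).2, le_div_iff₀ (by positivity), mul_assoc,
      inv_mul_le_iff₀ (by positivity)]
    exact h3
  calc _ ≤ 2 * ((k : ℝ) + 1) / (1 - a) / L 0 * (μ 0 / ((k : ℝ) + 1) ^ (2 * a)) ^ 2 :=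
        mul_le_mul_of_nonneg_right h5 (sq_nonneg _)
    _ = _ := by
      have := hL 0
      have h2 : 2 - 2 * a = 2 * (1 - a) := by ring
      rw [h2]
      field_simp
      norm_num
end

section
/- For every z ∈ ℝ^n, with x⁺ := p_ℓ(x,y,μ): min_{i=1,…,m} [F̃_i(x⁺, μ) − F_i(z)] + κμ ≤ (ℓ/2) · [2⟨y − x⁺, y − z⟩ − ‖x⁺ − y‖²] + 2κμ. -/
open scoped RealInnerProductSpace

/-- The function `φ_ℓ(·; x, y, μ)` of the subproblem, where `ftil i w ν = f̃ᵢ(w, ν)`. -/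
noncomputable def phiSub (n m : ℕ) (g : Fin m → EuclideanSpace ℝ (Fin n) → ℝ)
    (ftil : Fin m → EuclideanSpace ℝ (Fin n) → ℝ → ℝ)
    (x y : EuclideanSpace ℝ (Fin n)) (ℓ μ : ℝ) (z : EuclideanSpace ℝ (Fin n)) : ℝ :=
  (⨆ i : Fin m, (⟪gradient (fun v => ftil i v μ) y, z - y⟫ + g i z + ftil i y μ
      - (ftil i x μ + g i x))) + ℓ / 2 * ‖z - y‖ ^ 2

lemma line_deriv_aux {n : ℕ} (F : EuclideanSpace ℝ (Fin n) → ℝ) (hF : Differentiable ℝ F)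
    (y d : EuclideanSpace ℝ (Fin n)) (t : ℝ) :
    HasDerivAt (fun s : ℝ => F (y + s • d)) ⟪gradient F (y + t • d), d⟫ t := by
  have h1 : HasDerivAt (fun s : ℝ => y + s • d) d t := by
    simpa using ((hasDerivAt_id t).smul_const d).const_add y
  have h2 := ((hF (y + t • d)).hasGradientAt).hasFDerivAt
  have h3 := h2.comp_hasDerivAt t h1
  have e : ⟪gradient F (y + t • d), d⟫ =
      (InnerProductSpace.toDual ℝ (EuclideanSpace ℝ (Fin n)) (gradient F (y + t • d))) d := by
    rw [InnerProductSpace.toDual_apply_apply]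
  rw [e]
  exact h3

lemma convex_grad_aux {n : ℕ} (F : EuclideanSpace ℝ (Fin n) → ℝ) (hF : Differentiable ℝ F)
    (hc : ConvexOn ℝ Set.univ F) (y z : EuclideanSpace ℝ (Fin n)) :
    F y + ⟪gradient F y, z - y⟫ ≤ F z := by
  have hd := line_deriv_aux F hF y (z - y) 0
  have hcc : ConvexOn ℝ Set.univ (fun s : ℝ => F (y + s • (z - y))) := by
    refine ⟨convex_univ, ?_⟩
    intro a _ b _ p q hp hq hpq
    have := hc.2 (Set.mem_univ (y + a • (z - y))) (Set.mem_univ (y + b • (z - y))) hp hq hpq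
    convert this using 2
    have : y = (p + q) • y := by rw [hpq, one_smul]
    simp only [smul_eq_mul]
    nth_rewrite 1 [this]
    module
  have := hcc.le_slope_of_hasDerivAt (Set.mem_univ (0:ℝ)) (Set.mem_univ (1:ℝ)) one_pos hd
  simp only [slope_def_field, zero_smul, one_smul, add_zero, add_sub_cancel, sub_zero, div_one] at this
  linarith

lemma descent_aux {n : ℕ} (F : EuclideanSpace ℝ (Fin n) → ℝ) (hF : Differentiable ℝ F)
    (ℓ : ℝ) (hℓ : 0 < ℓ) (hL : LipschitzWith (Real.toNNReal ℓ) (fun w => gradient F w))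
    (y z : EuclideanSpace ℝ (Fin n)) :
    F z ≤ F y + ⟪gradient F y, z - y⟫ + ℓ / 2 * ‖z - y‖ ^ 2 := by
  set d := z - y with hd
  have hder : ∀ t : ℝ, HasDerivAt
      (fun s : ℝ => F (y + s • d) - s * ⟪gradient F y, d⟫ - s ^ 2 * (ℓ / 2 * ‖d‖ ^ 2))
      (⟪gradient F (y + t • d), d⟫ - ⟪gradient F y, d⟫ - 2 * t * (ℓ / 2 * ‖d‖ ^ 2)) t := by
    intro t
    have h1 := line_deriv_aux F hF y d t
    have h2 := (hasDerivAt_id t).mul_const ⟪gradient F y, d⟫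
    have h3 := ((hasDerivAt_id t).pow 2).mul_const (ℓ / 2 * ‖d‖ ^ 2)
    have h4 := (h1.sub h2).sub h3
    refine (h4.congr_deriv ?_)
    simp only [id, one_mul, mul_one, Nat.cast_ofNat]
    ring
  have hanti : AntitoneOn
      (fun s : ℝ => F (y + s • d) - s * ⟪gradient F y, d⟫ - s ^ 2 * (ℓ / 2 * ‖d‖ ^ 2))
      (Set.Icc 0 1) := by
    apply antitoneOn_of_deriv_nonpos (convex_Icc 0 1)
    · exact fun t _ => (hder t).continuousAt.continuousWithinAt
    · exact fun t _ => (hder t).differentiableAt.differentiableWithinAt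
    · intro t ht
      rw [interior_Icc] at ht
      rw [(hder t).deriv, ← inner_sub_left]
      have h1 := real_inner_le_norm (gradient F (y + t • d) - gradient F y) d
      have h2 := hL.dist_le_mul (y + t • d) y
      rw [dist_eq_norm, dist_eq_norm, Real.coe_toNNReal _ hℓ.le, add_sub_cancel_left,
        norm_smul, Real.norm_eq_abs, abs_of_pos ht.1] at h2
      have h3 := mul_le_mul_of_nonneg_right h2 (norm_nonneg d)
      nlinarith
  have := hanti (Set.left_mem_Icc.2 zero_le_one) (Set.right_mem_Icc.2 zero_le_one) zero_le_one
  simp only [hd, one_smul, zero_smul, add_sub_cancel, add_zero] at this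
  simp only [hd]
  linarith

theorem stmt_11 (n m : ℕ) (hn : 1 ≤ n) (hm : 1 ≤ m)
    (g f : Fin m → EuclideanSpace ℝ (Fin n) → ℝ)
    (ftil : Fin m → EuclideanSpace ℝ (Fin n) → ℝ → ℝ)
    (μ ℓ κ : ℝ) (hμ : 0 < μ) (hℓ : 0 < ℓ) (hκ : 0 < κ)
    (hg : ∀ i, ConvexOn ℝ Set.univ (g i))
    (hfconv : ∀ i, ConvexOn ℝ Set.univ (f i))
    (hftil : ∀ i, ∀ ν : ℝ, 0 < ν →
      ConvexOn ℝ Set.univ (fun w => ftil i w ν) ∧ ContDiff ℝ 1 (fun w => ftil i w ν))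
    (hlip : ∀ i, LipschitzWith (Real.toNNReal ℓ) (fun w => gradient (fun v => ftil i v μ) w))
    (happrox : ∀ i, ∀ w, ∀ ν : ℝ, 0 < ν → |ftil i w ν - f i w| ≤ κ * ν)
    (x y xplus : EuclideanSpace ℝ (Fin n))
    (hmin : ∀ w : EuclideanSpace ℝ (Fin n),
      phiSub n m g ftil x y ℓ μ xplus ≤ phiSub n m g ftil x y ℓ μ w)
    (z : EuclideanSpace ℝ (Fin n)) :
    (⨅ i : Fin m, ((ftil i xplus μ + g i xplus) - (f i z + g i z))) + κ * μ ≤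
      ℓ / 2 * (2 * ⟪y - xplus, y - z⟫ - ‖xplus - y‖ ^ 2) + 2 * κ * μ := by
  have : Nonempty (Fin m) := ⟨⟨0, hm⟩⟩
  have hdiff : ∀ i, Differentiable ℝ (fun w => ftil i w μ) := fun i =>
    (hftil i μ hμ).2.differentiable one_ne_zero
  set h : Fin m → EuclideanSpace ℝ (Fin n) → ℝ := fun i w =>
    ⟪gradient (fun v => ftil i v μ) y, w - y⟫ + g i w + ftil i y μ
      - (ftil i x μ + g i x) with hh
  have hphi : ∀ w, phiSub n m g ftil x y ℓ μ w = (⨆ i, h i w) + ℓ / 2 * ‖w - y‖ ^ 2 :=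
    fun w => rfl
  have hle : ∀ i w, h i w ≤ ⨆ j, h j w := fun i w =>
    le_ciSup (f := fun j => h j w) (Set.finite_range _).bddAbove i
  -- strong convexity
  have hkey : ∀ t : ℝ, 0 < t → t < 1 →
      (1 - t) * (ℓ / 2 * ‖z - xplus‖ ^ 2) ≤ ((⨆ i, h i z) + ℓ / 2 * ‖z - y‖ ^ 2)
        - ((⨆ i, h i xplus) + ℓ / 2 * ‖xplus - y‖ ^ 2) := by
    intro t ht0 ht1
    have h1 := hmin ((1 - t) • xplus + t • z)
    rw [hphi, hphi] at h1
    have h2 : (⨆ i, h i ((1 - t) • xplus + t • z)) ≤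
        (1 - t) * (⨆ i, h i xplus) + t * (⨆ i, h i z) := by
      apply ciSup_le
      intro i
      have e1 := mul_le_mul_of_nonneg_left (hle i xplus) (sub_nonneg.2 ht1.le)
      have e2 := mul_le_mul_of_nonneg_left (hle i z) ht0.le
      have e3 := (hg i).2 (Set.mem_univ xplus) (Set.mem_univ z) (sub_nonneg.2 ht1.le) ht0.le
        (by ring)
      simp only [smul_eq_mul] at e3
      have e4 : (1 - t) • xplus + t • z - y = (1 - t) • (xplus - y) + t • (z - y) := by module
      refine le_trans ?_ (add_le_add e1 e2)
      simp only [hh, e4, inner_add_right, inner_smul_right]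
      linarith
    have h3 : ‖(1 - t) • xplus + t • z - y‖ ^ 2 = (1 - t) * ‖xplus - y‖ ^ 2 + t * ‖z - y‖ ^ 2
        - t * (1 - t) * ‖z - xplus‖ ^ 2 := by
      have e4 : (1 - t) • xplus + t • z - y = (1 - t) • (xplus - y) + t • (z - y) := by module
      have e5 : z - xplus = (z - y) - (xplus - y) := by abel
      rw [e4, e5]
      generalize xplus - y = a
      generalize z - y = b
      rw [norm_add_sq_real, norm_sub_sq_real, norm_smul, norm_smul, inner_smul_left,
        inner_smul_right, mul_pow, mul_pow, Real.norm_eq_abs, Real.norm_eq_abs, sq_abs, sq_abs,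
        real_inner_comm a b]
      simp
      ring
    rw [h3] at h1
    refine le_of_mul_le_mul_left ?_ ht0
    linarith
  have hstrong : ℓ / 2 * ‖z - xplus‖ ^ 2 ≤ ((⨆ i, h i z) + ℓ / 2 * ‖z - y‖ ^ 2)
        - ((⨆ i, h i xplus) + ℓ / 2 * ‖xplus - y‖ ^ 2) := by
    have hB : 0 ≤ ℓ / 2 * ‖z - xplus‖ ^ 2 := by positivity
    refine le_of_forall_pos_le_add ?_
    intro ε hε
    set B := ℓ / 2 * ‖z - xplus‖ ^ 2
    have := hkey (ε / (B + ε + 1)) (by positivity) (by rw [div_lt_one (by positivity)]; linarith)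
    have h5 : ε / (B + ε + 1) * B ≤ ε := by
      rw [div_mul_eq_mul_div, div_le_iff₀ (by positivity)]
      nlinarith
    linarith
  obtain ⟨i, hi⟩ := exists_eq_ciSup_of_finite (f := fun i => h i z)
  have hi' : h i z = ⨆ i, h i z := hi
  have h1 := hle i xplus
  have h2 := descent_aux _ (hdiff i) ℓ hℓ (hlip i) y xplus
  have h3 := convex_grad_aux _ (hdiff i) (hftil i μ hμ).1 y z
  have h4 := (abs_le.1 (happrox i z μ hμ)).2
  have h5 : (⨅ i : Fin m, ((ftil i xplus μ + g i xplus) - (f i z + g i z))) ≤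
      (ftil i xplus μ + g i xplus) - (f i z + g i z) :=
    ciInf_le (Set.finite_range _).bddBelow i
  have h6 : ‖z - xplus‖ ^ 2 = ‖z - y‖ ^ 2 - (2 * ⟪y - xplus, y - z⟫ - ‖xplus - y‖ ^ 2) := by
    have e5 : z - xplus = (y - xplus) - (y - z) := by abel
    rw [e5, norm_sub_sq_real, norm_sub_rev xplus y, norm_sub_rev z y]
    ring
  rw [← hi', h6] at hstrong
  simp only [hh] at hstrong h1
  linarith
end

section
/- For every k ≥ 1: a_k ≤ (ηL/ℓ_0) · a_0 + ηL · [κμ_0 + ((ηL)^{−1} − ℓ_0^{−1}) · a*]. -/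
/-- under the sequence hypotheses (with `a q` playing the role of
`F̃ᵢ(x_q, μ_q)`), for every `k ≥ 1`:
`a k ≤ (ηL/ℓ₀) a₀ + ηL [κμ₀ + ((ηL)⁻¹ − ℓ₀⁻¹) a*]`. -/
theorem stmt_14 (n : ℕ) (x : ℕ → EuclideanSpace ℝ (Fin n))
    (a : ℕ → ℝ) (astar : ℝ) (ha : ∀ q, astar ≤ a q)
    (η L : ℝ) (hη : 1 < η) (hL : 0 < L)
    (ℓ : ℕ → ℝ) (hℓmono : Monotone ℓ) (hℓ0 : 1 ≤ ℓ 0) (hℓub : ∀ q, ℓ q ≤ η * L)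
    (κ μ₀ : ℝ) (hκ : 0 ≤ κ) (hμ₀ : 0 ≤ μ₀)
    (θ : ℕ → ℝ) (hθ1 : θ 1 = 0) (hθ : ∀ q : ℕ, 1 ≤ q → θ q ^ 2 ≤ 1)
    (h1 : a 1 ≤ a 0 + κ * μ₀)
    (hrec : ∀ q : ℕ, 1 ≤ q → a q - a (q + 1) ≥
      ℓ q / 2 * (‖x (q + 1) - x q‖ ^ 2 - θ q ^ 2 * ‖x q - x (q - 1)‖ ^ 2)) :
    ∀ k : ℕ, 1 ≤ k →
      a k ≤ η * L / ℓ 0 * a 0 + η * L * (κ * μ₀ + ((η * L)⁻¹ - (ℓ 0)⁻¹) * astar) := by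
  have hpos : ∀ q, 0 < ℓ q := fun q => by
    have := hℓmono (Nat.zero_le q)
    linarith
  have key : ∀ q : ℕ, 1 ≤ q →
      (a q - astar) / ℓ q + θ q ^ 2 * ‖x q - x (q - 1)‖ ^ 2 / 2 ≤ (a 1 - astar) / ℓ 0 := by
    intro q hq
    induction q, hq using Nat.le_induction with
    | base =>
      have h : (a 1 - astar) / ℓ 1 ≤ (a 1 - astar) / ℓ 0 :=
        div_le_div_of_nonneg_left (by linarith [ha 1]) (hpos 0) (hℓmono (Nat.zero_le 1))
      rw [hθ1]
      linarith
    | succ q hq ih =>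
      have h := hrec q hq
      have e1 : (a (q+1) - astar) / ℓ (q+1) ≤ (a (q+1) - astar) / ℓ q :=
        div_le_div_of_nonneg_left (by linarith [ha (q+1)]) (hpos q) (hℓmono (Nat.le_succ q))
      have e2 : θ (q+1) ^ 2 * ‖x (q+1) - x q‖ ^ 2 ≤ 1 * ‖x (q+1) - x q‖ ^ 2 :=
        mul_le_mul_of_nonneg_right (hθ (q+1) (by omega)) (by positivity)
      have e3 : (a (q+1) - astar) / ℓ q ≤ (a q - astar) / ℓ q -
          (‖x (q + 1) - x q‖ ^ 2 - θ q ^ 2 * ‖x q - x (q - 1)‖ ^ 2) / 2 := by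
        rw [div_le_iff₀ (hpos q), sub_mul, div_mul_cancel₀ _ (hpos q).ne']
        linarith
      rw [Nat.add_sub_cancel]
      linarith
  intro k hk
  have hk1 := key k hk
  have hM : 0 < η * L := lt_of_lt_of_le (hpos 0) (hℓub 0)
  have f1 : (a k - astar) / (η * L) ≤ (a k - astar) / ℓ k :=
    div_le_div_of_nonneg_left (by linarith [ha k]) (hpos k) (hℓub k)
  have f2 : 0 ≤ θ k ^ 2 * ‖x k - x (k - 1)‖ ^ 2 / 2 := by positivity
  have f3 : (a 1 - astar) / ℓ 0 ≤ (a 0 - astar + κ * μ₀) / ℓ 0 :=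
    div_le_div_of_nonneg_right (by linarith) (hpos 0).le
  have f4 : κ * μ₀ / ℓ 0 ≤ κ * μ₀ := div_le_self (by positivity) hℓ0
  rw [add_div] at f3
  have f5 : (a k - astar) / (η * L) ≤ (a 0 - astar) / ℓ 0 + κ * μ₀ := by linarith
  rw [div_le_iff₀ hM] at f5
  have f6 : η * L / ℓ 0 * a 0 + η * L * (κ * μ₀ + ((η * L)⁻¹ - (ℓ 0)⁻¹) * astar)
      = ((a 0 - astar) / ℓ 0 + κ * μ₀) * (η * L) + η * L * (η * L)⁻¹ * astar := by
    ring
  rw [f6, mul_inv_cancel₀ hM.ne']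
  linarith
end

section
/- Under the two hypotheses on W_k and W_{k+1}, it holds that 2 L_{k−1}^{−1} μ_{k−1} t_{k−1}² W_k − 2 L_k^{−1} μ_k t_k² W_{k+1} ≥ ‖u_{k+1}‖² − ‖u_k‖² − 4κ L_k^{−1} t_k μ_k². -/
open scoped RealInnerProductSpace

/-- under the two hypotheses on `W_k` and `W_{k+1}`,
`2 L_{k−1}⁻¹ μ_{k−1} t_{k−1}² W_k − 2 L_k⁻¹ μ_k t_k² W_{k+1}
  ≥ ‖u_{k+1}‖² − ‖u_k‖² − 4κ L_k⁻¹ t_k μ_k²`. -/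
theorem stmt_15 (n : ℕ)
    (xkm xk xk1 z : EuclideanSpace ℝ (Fin n))
    (μkm μk Lkm Lk : ℝ) (hμkm : 0 < μkm) (hμk : 0 < μk) (hLkm : 0 < Lkm) (hLk : 0 < Lk)
    (κ : ℝ) (hκ : 0 ≤ κ)
    (tkm tk : ℝ) (htkm : 1 ≤ tkm) (htk : 1 ≤ tk)
    (ht : Lk⁻¹ * μk * tk * (tk - 1) = Lkm⁻¹ * μkm * tkm ^ 2)
    (θk : ℝ) (hθk : θk = (tkm - 1) / tk)
    (yk : EuclideanSpace ℝ (Fin n)) (hyk : yk = xk + θk • (xk - xkm))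
    (uk uk1 : EuclideanSpace ℝ (Fin n))
    (huk : uk = tkm • xk - (tkm - 1) • xkm - z)
    (huk1 : uk1 = tk • xk1 - (tk - 1) • xk - z)
    (Wk Wk1 : ℝ)
    (hW1 : Wk1 ≤ Wk - Lk * μk⁻¹ / 2 *
      (2 * ⟪xk1 - yk, yk - xk⟫ + ‖xk1 - yk‖ ^ 2))
    (hW2 : Wk1 ≤ Lk * μk⁻¹ / 2 *
      (2 * ⟪yk - xk1, yk - z⟫ - ‖xk1 - yk‖ ^ 2) + 2 * κ * μk) :
    2 * Lkm⁻¹ * μkm * tkm ^ 2 * Wk - 2 * Lk⁻¹ * μk * tk ^ 2 * Wk1 ≥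
      ‖uk1‖ ^ 2 - ‖uk‖ ^ 2 - 4 * κ * Lk⁻¹ * tk * μk ^ 2 := by
  have htk0 : 0 < tk := by linarith
  have hu : uk = (tk - 1) • (yk - xk) + (yk - z) := by
    have h1 : tk * θk = tkm - 1 := by rw [hθk]; field_simp
    have h2 : tkm = tk * θk + 1 := by linarith
    rw [huk, hyk, h2]
    module
  have hu1 : uk1 = uk + tk • (xk1 - yk) := by
    rw [hu, huk1]
    module
  have hneg : ⟪yk - xk1, yk - z⟫ = -⟪xk1 - yk, yk - z⟫ := by
    rw [← inner_neg_left, neg_sub]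
  have hin : ⟪uk, xk1 - yk⟫ = (tk - 1) * ⟪xk1 - yk, yk - xk⟫ + ⟪xk1 - yk, yk - z⟫ := by
    rw [hu, real_inner_comm, inner_add_right, real_inner_smul_right]
  have hnorm : ‖uk1‖ ^ 2 = ‖uk‖ ^ 2 + 2 * (tk * ⟪uk, xk1 - yk⟫) + tk ^ 2 * ‖xk1 - yk‖ ^ 2 := by
    rw [hu1, norm_add_sq_real, real_inner_smul_right, norm_smul, mul_pow, Real.norm_eq_abs,
      sq_abs]
  rw [hneg] at hW2
  rw [hnorm, hin]
  have hc : 0 < Lk⁻¹ * μk := by positivity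
  have hcc : (Lk⁻¹ * μk) * (Lk * μk⁻¹) = 1 := by field_simp
  have e1 : 2 * Lkm⁻¹ * μkm * tkm ^ 2 * Wk = 2 * (Lk⁻¹ * μk) * (tk * (tk - 1)) * Wk := by
    linear_combination (-2 * Wk) * ht
  rw [e1]
  have m1 := mul_le_mul_of_nonneg_left hW1
    (show 0 ≤ 2 * (Lk⁻¹ * μk) * (tk * (tk - 1)) from
      mul_nonneg (by positivity) (mul_nonneg htk0.le (by linarith)))
  have m2 := mul_le_mul_of_nonneg_left hW2 (show 0 ≤ 2 * (Lk⁻¹ * μk) * tk by positivity)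
  generalize ⟪xk1 - yk, yk - xk⟫ = P at *
  generalize ⟪xk1 - yk, yk - z⟫ = Q at *
  generalize ‖xk1 - yk‖ ^ 2 = D at *
  have r1 : 2 * (Lk⁻¹ * μk) * (tk * (tk - 1)) * (Wk - Lk * μk⁻¹ / 2 * (2 * P + D))
      = 2 * (Lk⁻¹ * μk) * (tk * (tk - 1)) * Wk - tk * (tk - 1) * (2 * P + D) := by
    linear_combination (-(tk * (tk - 1) * (2 * P + D))) * hcc
  have r2 : 2 * (Lk⁻¹ * μk) * tk * (Lk * μk⁻¹ / 2 * (2 * -Q - D) + 2 * κ * μk)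
      = tk * (2 * -Q - D) + 4 * κ * Lk⁻¹ * tk * μk ^ 2 := by
    linear_combination (tk * (2 * -Q - D)) * hcc
  rw [r1] at m1
  rw [r2] at m2
  linarith
end

section
/- There exists a constant C > 0 such that for all integers k ≥ 2: W_{k+1} ≤ C k^{−σ} if 0 < σ < 1; W_{k+1} ≤ C (ln k)/k if σ = 1; and W_{k+1} ≤ C k^{σ−2} if 1 < σ < 2. -/
open scoped RealInnerProductSpace

lemma aux_sum_rpow (p : ℝ) (hp : 0 < p) (hp1 : p ≤ 1) (k : ℕ) :
    ∑ i ∈ Finset.range k, ((i + 1 : ℕ) : ℝ) ^ (p - 1) ≤ (k : ℝ) ^ p / p := by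
  induction k with
  | zero => simp [Real.zero_rpow hp.ne']
  | succ k ih =>
    rw [Finset.sum_range_succ]
    set m : ℝ := ((k + 1 : ℕ) : ℝ) with hm
    have hm1 : (1 : ℝ) ≤ m := by rw [hm]; push_cast; linarith [Nat.cast_nonneg (α := ℝ) k]
    have hm0 : 0 < m := by linarith
    have hk : (k : ℝ) = m * (1 + (-(1 / m))) := by
      field_simp; rw [hm]; push_cast; ring
    have hinv : 1 / m ≤ 1 := by rw [div_le_one hm0]; exact hm1
    have hB : (1 + (-(1 / m))) ^ p ≤ 1 + p * (-(1 / m)) :=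
      rpow_one_add_le_one_add_mul_self (by linarith) hp.le hp1
    have hkp : (k : ℝ) ^ p ≤ m ^ p - p * m ^ (p - 1) := by
      rw [hk, Real.mul_rpow hm0.le (by linarith), Real.rpow_sub_one hm0.ne']
      calc m ^ p * (1 + (-(1 / m))) ^ p ≤ m ^ p * (1 + p * (-(1 / m))) := by gcongr
        _ = _ := by ring
    have : (k : ℝ) ^ p / p ≤ m ^ p / p - m ^ (p - 1) := by
      rw [div_le_iff₀ hp]
      calc _ ≤ _ := hkp
        _ = _ := by field_simp
    linarith

lemma aux_energy {E : Type*} [NormedAddCommGroup E] [InnerProductSpace ℝ E]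
    (x y x' z : E) (a t w w' e : ℝ) (ha : 0 < a) (ht : 1 ≤ t)
    (h1 : w' ≤ w - a / 2 * (2 * ⟪x' - y, y - x⟫ + ‖x' - y‖ ^ 2))
    (h2 : w' ≤ a / 2 * (2 * ⟪y - x', y - z⟫ - ‖x' - y‖ ^ 2) + e) :
    t ^ 2 / a * w' + 1 / 2 * ‖t • x' - (t - 1) • x - z‖ ^ 2 ≤
      (t ^ 2 - t) / a * w + 1 / 2 * ‖t • y - (t - 1) • x - z‖ ^ 2 + t / a * e := by
  have e1 : t • x' - (t - 1) • x - z = (t • y - (t - 1) • x - z) - t • (y - x') := by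
    module
  have e2 : t • y - (t - 1) • x - z = (t - 1) • (y - x) + (y - z) := by module
  have e3 : x' - y = -(y - x') := by abel
  rw [e1, norm_sub_sq_real, e2]
  rw [e3] at h1 h2
  rw [inner_neg_left, norm_neg] at h1
  rw [norm_neg] at h2
  rw [norm_smul, real_inner_smul_right, inner_add_left, real_inner_smul_left,
    real_inner_comm (y - x') (y - x), real_inner_comm (y - x') (y - z), mul_pow, Real.norm_eq_abs,
    sq_abs]
  set p := ⟪y - x', y - x⟫
  set q := ⟪y - x', y - z⟫
  set N := ‖y - x'‖ ^ 2
  have h3 := mul_le_mul_of_nonneg_left h1 (by linarith : 0 ≤ t - 1)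
  have h4 : t * w' ≤ (t - 1) * w + a / 2 * (2 * ((t - 1) * p + q) - t * N) + e := by
    nlinarith
  have h5 := mul_le_mul_of_nonneg_left h4 (by positivity : 0 ≤ t / a)
  have h6 : t / a * ((t - 1) * w + a / 2 * (2 * ((t - 1) * p + q) - t * N) + e)
     = (t ^ 2 - t) / a * w + t * ((t - 1) * p + q) - t ^ 2 * N / 2 + t / a * e := by
    field_simp
    ring
  have h7 : t / a * (t * w') = t ^ 2 / a * w' := by ring
  rw [h6, h7] at h5
  nlinarith

lemma aux_rec (r r' b : ℝ) (hr : 0 ≤ r) (hb : 0 ≤ b) (hr' : b ≤ r')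
    (h : r' ^ 2 - b * r' = r ^ 2) : r + b / 2 ≤ r' ∧ r' ≤ r + b := by
  constructor
  · have : r ≤ r' - b / 2 := by
      apply le_of_sq_le_sq _ (by linarith)
      nlinarith
    linarith
  · by_contra hc
    push Not at hc
    nlinarith

set_option maxHeartbeats 2000000 in
/-- under the stated hypotheses there exists `C > 0` such that for all
`k ≥ 2`: `W_{k+1} ≤ C k^{−σ}` if `0 < σ < 1`, `W_{k+1} ≤ C (ln k)/k` if `σ = 1`, and
`W_{k+1} ≤ C k^{σ−2}` if `1 < σ < 2`. -/
theorem stmt_16 (n : ℕ) (σ κ : ℝ) (hσ : 0 < σ ∧ σ < 2) (hκ : 0 < κ)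
    (μ L t θ : ℕ → ℝ) (Lbar : ℝ)
    (hμ0 : 0 < μ 0 ∧ μ 0 ≤ 1)
    (hμ : ∀ k : ℕ, 1 ≤ k → μ k = μ 0 / (k : ℝ) ^ σ)
    (hL0 : 1 ≤ L 0) (hLk : ∀ k, L 0 ≤ L k ∧ L k ≤ Lbar)
    (ht0 : t 0 = 1)
    (htrec : ∀ k, t (k + 1) =
      (1 + Real.sqrt (1 + 4 * (μ k * L (k + 1) / (μ (k + 1) * L k)) * (t k) ^ 2)) / 2)
    (hθ : ∀ k : ℕ, 1 ≤ k → θ k = (t (k - 1) - 1) / t k)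
    (z : EuclideanSpace ℝ (Fin n)) (x y : ℕ → EuclideanSpace ℝ (Fin n))
    (hy0 : y 0 = x 0)
    (hyk : ∀ k : ℕ, 1 ≤ k → y k = x k + θ k • (x k - x (k - 1)))
    (W : ℕ → ℝ)
    (hW1 : ∀ k : ℕ, 1 ≤ k → W (k + 1) ≤ W k - L k * (μ k)⁻¹ / 2 *
      (2 * ⟪x (k + 1) - y k, y k - x k⟫ + ‖x (k + 1) - y k‖ ^ 2))
    (hW2 : ∀ k : ℕ, 1 ≤ k → W (k + 1) ≤ L k * (μ k)⁻¹ / 2 *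
      (2 * ⟪y k - x (k + 1), y k - z⟫ - ‖x (k + 1) - y k‖ ^ 2) + 2 * κ * μ k)
    (hWinit : W 1 ≤ L 0 * (μ 0)⁻¹ / 2 *
      (2 * ⟪x 0 - x 1, x 0 - z⟫ - ‖x 1 - x 0‖ ^ 2) + 2 * κ * μ 0) :
    ∃ C : ℝ, 0 < C ∧ ∀ k : ℕ, 2 ≤ k →
      (σ < 1 → W (k + 1) ≤ C * (k : ℝ) ^ (-σ)) ∧
      (σ = 1 → W (k + 1) ≤ C * Real.log k / k) ∧
      (1 < σ → W (k + 1) ≤ C * (k : ℝ) ^ (σ - 2)) := by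
  
  obtain ⟨hσ0, hσ2⟩ := hσ
  obtain ⟨hμ00, hμ01⟩ := hμ0
  have hLpos : ∀ k, 1 ≤ L k := fun k => hL0.trans (hLk k).1
  have hμpos : ∀ k, 0 < μ k := by
    intro k
    rcases Nat.eq_zero_or_pos k with rfl | hk
    · exact hμ00
    · rw [hμ k hk]
      have : (0 : ℝ) < k := by exact_mod_cast hk
      positivity
  have hapos : ∀ k, 0 < L k * (μ k)⁻¹ := fun k =>
    mul_pos (by linarith [hLpos k]) (inv_pos.2 (hμpos k))
  have ht1 : ∀ k, 1 ≤ t k := by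
    intro k
    cases k with
    | zero => rw [ht0]
    | succ k =>
      rw [htrec]
      have : 1 ≤ Real.sqrt (1 + 4 * (μ k * L (k + 1) / (μ (k + 1) * L k)) * (t k) ^ 2) := by
        rw [Real.one_le_sqrt]
        have := hμpos k
        have := hμpos (k + 1)
        have := hLpos k
        have := hLpos (k + 1)
        have : 0 ≤ 4 * (μ k * L (k + 1) / (μ (k + 1) * L k)) * (t k) ^ 2 := by positivity
        linarith
      linarith
  have htq : ∀ k, (t (k + 1) ^ 2 - t (k + 1)) / (L (k + 1) * (μ (k + 1))⁻¹)
      = t k ^ 2 / (L k * (μ k)⁻¹) := by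
    intro k
    have h1 := hμpos k
    have h2 := hμpos (k + 1)
    have h3 := hLpos k
    have h4 := hLpos (k + 1)
    have h5 : 0 ≤ 1 + 4 * (μ k * L (k + 1) / (μ (k + 1) * L k)) * (t k) ^ 2 := by positivity
    have h6 := Real.sq_sqrt h5
    have h7 : t (k + 1) ^ 2 - t (k + 1) = μ k * L (k + 1) / (μ (k + 1) * L k) * (t k) ^ 2 := by
      have h8 : Real.sqrt (1 + 4 * (μ k * L (k + 1) / (μ (k + 1) * L k)) * (t k) ^ 2)
        = 2 * t (k + 1) - 1 := by rw [htrec k]; ring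
      rw [h8] at h6
      linarith
    rw [h7]
    field_simp
  -- energy estimate
  have hen : ∀ k, t k ^ 2 / (L k * (μ k)⁻¹) * W (k + 1)
      + 1 / 2 * ‖t k • x (k + 1) - (t k - 1) • x k - z‖ ^ 2 ≤
      1 / 2 * ‖x 0 - z‖ ^ 2 + (t 0 / (L 0 * (μ 0)⁻¹) * (2 * κ * μ 0) +
        ∑ i ∈ Finset.range k, t (i + 1) / (L (i + 1) * (μ (i + 1))⁻¹) * (2 * κ * μ (i + 1))) := by
    intro k
    induction k with
    | zero =>
      have h := aux_energy (x 0) (x 0) (x 1) z (L 0 * (μ 0)⁻¹) (t 0)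
        (W 1 + L 0 * (μ 0)⁻¹ / 2 * (2 * ⟪x 1 - x 0, x 0 - x 0⟫ + ‖x 1 - x 0‖ ^ 2))
        (W 1) (2 * κ * μ 0) (hapos 0) (ht1 0) (by linarith) hWinit
      rw [ht0] at h ⊢
      simp only [one_pow, sub_self, zero_div, zero_mul, zero_smul, sub_zero, one_smul] at h
      simp only [one_pow, sub_self, zero_smul, sub_zero, one_smul, Finset.range_zero,
        Finset.sum_empty, zero_add]
      linarith
    | succ k ih =>
      have h := aux_energy (x (k + 1)) (y (k + 1)) (x (k + 1 + 1)) z (L (k + 1) * (μ (k + 1))⁻¹)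
        (t (k + 1)) (W (k + 1)) (W (k + 1 + 1)) (2 * κ * μ (k + 1)) (hapos _) (ht1 _)
        (hW1 _ (by omega)) (hW2 _ (by omega))
      rw [htq] at h
      have hv : t (k + 1) • y (k + 1) - (t (k + 1) - 1) • x (k + 1) - z
          = t k • x (k + 1) - (t k - 1) • x k - z := by
        have htp : t (k + 1) ≠ 0 := by linarith [ht1 (k + 1)]
        rw [hyk _ (by omega), hθ _ (by omega), Nat.add_sub_cancel, smul_add, smul_smul,
          mul_div_cancel₀ _ htp]
        module
      rw [hv] at h
      rw [Finset.sum_range_succ]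
      linarith
  -- scaling sequence
  have hb0 : ∀ k, 0 < μ k / L k := fun k => div_pos (hμpos k) (by linarith [hLpos k])
  obtain ⟨b, hb⟩ : ∃ b : ℕ → ℝ, b = fun k => Real.sqrt (μ k / L k) := ⟨_, rfl⟩
  have hbpos : ∀ k, 0 < b k := fun k => by rw [hb]; exact Real.sqrt_pos.2 (hb0 k)
  have hbsq : ∀ k, b k ^ 2 = μ k / L k := fun k => by rw [hb]; exact Real.sq_sqrt (hb0 k).le
  have hainv : ∀ (k : ℕ) (c : ℝ), c / (L k * (μ k)⁻¹) = c * b k ^ 2 := by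
    intro k c
    rw [hbsq]
    have := hμpos k
    have := hLpos k
    field_simp
  have hrec : ∀ k, t k * b k + b (k + 1) / 2 ≤ t (k + 1) * b (k + 1) ∧
      t (k + 1) * b (k + 1) ≤ t k * b k + b (k + 1) := by
    intro k
    apply aux_rec
    · exact mul_nonneg (by linarith [ht1 k]) (hbpos k).le
    · exact (hbpos _).le
    · nlinarith [hbpos (k + 1), ht1 (k + 1)]
    · have := htq k
      rw [hainv, hainv] at this
      linarith
  have hLb : 1 ≤ Lbar := (hLpos 0).trans (hLk 0).2
  obtain ⟨c, hc⟩ : ∃ c : ℝ, c = Real.sqrt (μ 0 / Lbar) := ⟨_, rfl⟩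
  have hcpos : 0 < c := by rw [hc]; exact Real.sqrt_pos.2 (by positivity)
  have hpowsqrt : ∀ k : ℕ, ((k + 1 : ℕ) : ℝ) ^ (-(σ / 2)) =
      Real.sqrt (1 / ((k + 1 : ℕ) : ℝ) ^ σ) := by
    intro k
    rw [Real.sqrt_eq_rpow, one_div, ← Real.rpow_neg (by positivity), ← Real.rpow_mul (by positivity)]
    congr 1; ring
  have hbup : ∀ k : ℕ, b (k + 1) ≤ ((k + 1 : ℕ) : ℝ) ^ (-(σ / 2)) := by
    intro k
    rw [hpowsqrt, hb]
    apply Real.sqrt_le_sqrt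
    rw [hμ (k + 1) (by omega), div_div]
    have := hLpos (k + 1)
    have hp : 0 < ((k + 1 : ℕ) : ℝ) ^ σ := by positivity
    apply div_le_div₀ zero_le_one hμ01 hp
    nlinarith
  have hblow : ∀ k : ℕ, c * ((k + 1 : ℕ) : ℝ) ^ (-(σ / 2)) ≤ b (k + 1) := by
    intro k
    rw [hpowsqrt, hb, hc, ← Real.sqrt_mul (by positivity)]
    apply Real.sqrt_le_sqrt
    rw [hμ (k + 1) (by omega)]
    have := hLpos (k + 1)
    have h2 := (hLk (k + 1)).2
    have hp : 0 < ((k + 1 : ℕ) : ℝ) ^ σ := by positivity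
    rw [div_mul_div_comm, div_div, mul_one, mul_comm Lbar]
    gcongr
  have hup0 : ∀ k : ℕ, t k * b k ≤ b 0 +
      ∑ i ∈ Finset.range k, ((i + 1 : ℕ) : ℝ) ^ ((1 - σ / 2) - 1) := by
    intro k
    induction k with
    | zero => simp [ht0]
    | succ k ih =>
      rw [Finset.sum_range_succ]
      have h1 := (hrec k).2
      have h2 := hbup k
      have h3 : (1 - σ / 2) - 1 = -(σ / 2) := by ring
      rw [← h3] at h2
      linarith
  have hp0 : 0 < 1 - σ / 2 := by linarith
  obtain ⟨R, hR⟩ : ∃ R : ℝ, R = b 0 + 1 / (1 - σ / 2) := ⟨_, rfl⟩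
  have hRpos : 0 < R := by rw [hR]; have := hbpos 0; positivity
  have hup : ∀ k : ℕ, t (k + 1) * b (k + 1) ≤ R * ((k + 1 : ℕ) : ℝ) ^ (1 - σ / 2) := by
    intro k
    have h1 := hup0 (k + 1)
    have h2 := aux_sum_rpow (1 - σ / 2) hp0 (by linarith) (k + 1)
    have h3 : (1 : ℝ) ≤ ((k + 1 : ℕ) : ℝ) ^ (1 - σ / 2) :=
      Real.one_le_rpow (by push_cast; linarith [Nat.cast_nonneg (α := ℝ) k]) hp0.le
    have h4 := mul_le_mul_of_nonneg_left h3 (hbpos 0).le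
    rw [hR, add_mul, one_div_mul_eq_div]
    linarith
  have hlow : ∀ k : ℕ, c / 2 * ((k + 1 : ℕ) : ℝ) ^ (1 - σ / 2) ≤ t (k + 1) * b (k + 1) := by
    intro k
    have key : ∀ m : ℕ, m ≤ k + 1 → m * (c / 2 * ((k + 1 : ℕ) : ℝ) ^ (-(σ / 2))) ≤ t m * b m := by
      intro m
      induction m with
      | zero => intro _; simp [ht0, (hbpos 0).le]
      | succ m ih =>
        intro hm
        have h1 := ih (by omega)
        have h2 := (hrec m).1
        have h3 := hblow m
        have h4 : ((k + 1 : ℕ) : ℝ) ^ (-(σ / 2)) ≤ ((m + 1 : ℕ) : ℝ) ^ (-(σ / 2)) :=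
          Real.rpow_le_rpow_of_nonpos (by positivity) (by exact_mod_cast hm) (by linarith)
        have h5 := mul_le_mul_of_nonneg_left h4 hcpos.le
        rw [Nat.cast_succ m, add_mul]
        linarith
    have h1 := key (k + 1) le_rfl
    have h2 : ((k + 1 : ℕ) : ℝ) ^ (1 - σ / 2) =
        ((k + 1 : ℕ) : ℝ) * ((k + 1 : ℕ) : ℝ) ^ (-(σ / 2)) := by
      rw [sub_eq_add_neg, Real.rpow_add (by positivity), Real.rpow_one]
    rw [h2]
    linarith
  have hterm : ∀ i : ℕ, t (i + 1) / (L (i + 1) * (μ (i + 1))⁻¹) * (2 * κ * μ (i + 1)) ≤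
      2 * κ * R * ((i + 1 : ℕ) : ℝ) ^ (1 - 2 * σ) := by
    intro i
    have hN : (0 : ℝ) < ((i + 1 : ℕ) : ℝ) := by positivity
    have h1 : μ (i + 1) ≤ ((i + 1 : ℕ) : ℝ) ^ (-σ) := by
      rw [hμ (i + 1) (by omega), Real.rpow_neg hN.le, div_eq_mul_inv]
      have : 0 ≤ (((i + 1 : ℕ) : ℝ) ^ σ)⁻¹ := by positivity
      nlinarith
    have h2 : ((i + 1 : ℕ) : ℝ) ^ (1 - 2 * σ) = ((i + 1 : ℕ) : ℝ) ^ (1 - σ / 2) *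
        ((i + 1 : ℕ) : ℝ) ^ (-(σ / 2)) * ((i + 1 : ℕ) : ℝ) ^ (-σ) := by
      rw [← Real.rpow_add hN, ← Real.rpow_add hN]; congr 1; ring
    rw [hainv, h2]
    have h3 := hup i
    have h4 := hbup i
    have h5 := hμpos (i + 1)
    have h6 := hbpos (i + 1)
    calc t (i + 1) * b (i + 1) ^ 2 * (2 * κ * μ (i + 1))
        = 2 * κ * ((t (i + 1) * b (i + 1)) * b (i + 1) * μ (i + 1)) := by ring
      _ ≤ 2 * κ * ((R * ((i + 1 : ℕ) : ℝ) ^ (1 - σ / 2)) * ((i + 1 : ℕ) : ℝ) ^ (-(σ / 2)) *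
          ((i + 1 : ℕ) : ℝ) ^ (-σ)) := by gcongr
      _ = _ := by ring
  obtain ⟨M, hM⟩ : ∃ M : ℝ, M = 1 / 2 * ‖x 0 - z‖ ^ 2 + t 0 / (L 0 * (μ 0)⁻¹) * (2 * κ * μ 0) :=
    ⟨_, rfl⟩
  have hM0 : 0 ≤ M := by
    rw [hM, ht0]; have := hapos 0; positivity
  have hmain : ∀ (k : ℕ) (A B : ℝ), 2 ≤ k → 0 ≤ A → 0 ≤ B →
      M ≤ A * B → ∑ i ∈ Finset.range k, ((i + 1 : ℕ) : ℝ) ^ (1 - 2 * σ) ≤ A * B →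
      W (k + 1) ≤ (1 + 2 * κ * R) * A / (c / 2) ^ 2 * (B * (k : ℝ) ^ (σ - 2)) := by
    intro k A B hk hA hB h1 h2
    have h3 := hen k
    have h4 := Finset.sum_le_sum (s := Finset.range k) (fun i _ => hterm i)
    rw [← Finset.mul_sum] at h4
    have h5 := mul_le_mul_of_nonneg_left h2 (by positivity : 0 ≤ 2 * κ * R)
    have hkk : (0 : ℝ) < (k : ℝ) := by exact_mod_cast (by omega : 0 < k)
    have h6 : t k ^ 2 / (L k * (μ k)⁻¹) * W (k + 1) ≤ (1 + 2 * κ * R) * (A * B) := by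
      have : 0 ≤ ‖t k • x (k + 1) - (t k - 1) • x k - z‖ ^ 2 := by positivity
      linarith
    have hpp : (0 : ℝ) < (k : ℝ) ^ (2 - σ) := by positivity
    have h7 : (c / 2) ^ 2 * (k : ℝ) ^ (2 - σ) ≤ t k ^ 2 / (L k * (μ k)⁻¹) := by
      obtain ⟨j, rfl⟩ : ∃ j, k = j + 1 := ⟨k - 1, by omega⟩
      have h8 := hlow j
      have h9 := pow_le_pow_left₀ (by positivity) h8 2
      rw [hainv, ← mul_pow]
      refine le_trans (le_of_eq ?_) h9
      rw [mul_pow, ← Real.rpow_natCast (_ ^ (1 - σ / 2)), ← Real.rpow_mul hkk.le]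
      congr 2; push_cast; ring
    have hneg : (k : ℝ) ^ (σ - 2) = ((k : ℝ) ^ (2 - σ))⁻¹ := by
      rw [← Real.rpow_neg hkk.le]; congr 1; ring
    have hrhs : (1 + 2 * κ * R) * A / (c / 2) ^ 2 * (B * (k : ℝ) ^ (σ - 2)) =
        (1 + 2 * κ * R) * (A * B) / ((c / 2) ^ 2 * (k : ℝ) ^ (2 - σ)) := by
      rw [hneg]; field_simp
    rw [hrhs, le_div_iff₀ (by positivity)]
    rcases le_total 0 (W (k + 1)) with hw | hw
    · nlinarith
    · have : W (k + 1) * ((c / 2) ^ 2 * (k : ℝ) ^ (2 - σ)) ≤ 0 :=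
        mul_nonpos_of_nonpos_of_nonneg hw (by positivity)
      have : 0 ≤ (1 + 2 * κ * R) * (A * B) := by positivity
      linarith
  have hKpos : 0 < (1 + 2 * κ * R) := by positivity
  rcases lt_trichotomy σ 1 with h | h | h
  · have hA : 0 < M + 1 / (1 - σ) := by
      have : 0 < 1 - σ := by linarith
      positivity
    refine ⟨(1 + 2 * κ * R) * (M + 1 / (1 - σ)) / (c / 2) ^ 2, by positivity, fun k hk =>
      ⟨fun _ => ?_, fun h' => by linarith, fun h' => by linarith⟩⟩
    have hk1 : (1 : ℝ) ≤ k := by exact_mod_cast (by omega : 1 ≤ k)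
    have hk0 : (0 : ℝ) < k := by linarith
    have hB1 : (1 : ℝ) ≤ (k : ℝ) ^ (2 - 2 * σ) := Real.one_le_rpow hk1 (by linarith)
    have hs : 0 < 1 - σ := by linarith
    have h1 := hmain k (M + 1 / (1 - σ)) ((k : ℝ) ^ (2 - 2 * σ)) hk hA.le (by positivity) (by
      have : 0 < 1 / (1 - σ) := by positivity
      nlinarith) (by
      have h2 : ∑ i ∈ Finset.range k, ((i + 1 : ℕ) : ℝ) ^ (1 - 2 * σ) ≤
          ∑ i ∈ Finset.range k, (k : ℝ) ^ (1 - σ) * ((i + 1 : ℕ) : ℝ) ^ ((1 - σ) - 1) := by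
        apply Finset.sum_le_sum
        intro i hi
        have hi' := Finset.mem_range.1 hi
        have e : (1 - 2 * σ) = (1 - σ) + ((1 - σ) - 1) := by ring
        rw [e, Real.rpow_add (by positivity)]
        gcongr
        exact_mod_cast hi'
      rw [← Finset.mul_sum] at h2
      have h3 := mul_le_mul_of_nonneg_left (aux_sum_rpow (1 - σ) hs (by linarith) k)
        (by positivity : 0 ≤ (k : ℝ) ^ (1 - σ))
      have e : (k : ℝ) ^ (2 - 2 * σ) = (k : ℝ) ^ (1 - σ) * (k : ℝ) ^ (1 - σ) := by
        rw [← Real.rpow_add hk0]; congr 1; ring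
      have h4 : 0 ≤ M * (k : ℝ) ^ (2 - 2 * σ) := by positivity
      have h5 : (k : ℝ) ^ (1 - σ) * ((k : ℝ) ^ (1 - σ) / (1 - σ)) =
          1 / (1 - σ) * (k : ℝ) ^ (2 - 2 * σ) := by rw [e]; ring
      linarith)
    rw [← Real.rpow_add hk0] at h1
    have e : 2 - 2 * σ + (σ - 2) = -σ := by ring
    rwa [e] at h1
  · have hlog2 : 0 < Real.log 2 := Real.log_pos (by norm_num)
    have hA : 0 < (M + 1) / Real.log 2 + 1 := by positivity
    refine ⟨(1 + 2 * κ * R) * ((M + 1) / Real.log 2 + 1) / (c / 2) ^ 2, by positivity, fun k hk =>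
      ⟨fun h' => by linarith, fun _ => ?_, fun h' => by linarith⟩⟩
    have hk2 : (2 : ℝ) ≤ k := by exact_mod_cast hk
    have hlogk : Real.log 2 ≤ Real.log k := Real.log_le_log (by norm_num) hk2
    have hM1 : M + 1 ≤ (M + 1) / Real.log 2 * Real.log k := by
      rw [div_mul_eq_mul_div, le_div_iff₀ hlog2]
      gcongr
    have h1 := hmain k ((M + 1) / Real.log 2 + 1) (Real.log k) hk hA.le (by linarith)
      (by linarith) (by
      have h2 := harmonic_le_one_add_log k
      have h3 : ∑ i ∈ Finset.range k, ((i + 1 : ℕ) : ℝ) ^ (1 - 2 * σ) = (harmonic k : ℝ) := by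
        rw [harmonic]
        push_cast
        apply Finset.sum_congr rfl
        intro i _
        rw [h, show (1 - 2 * (1 : ℝ)) = -1 by norm_num, Real.rpow_neg_one]
      rw [h3]
      linarith)
    rw [h, show (1 - 2 : ℝ) = -1 by norm_num, Real.rpow_neg_one] at h1
    rw [mul_div_assoc, div_eq_mul_inv (Real.log k)]
    exact h1
  · have hsum : Summable (fun i : ℕ => ((i + 1 : ℕ) : ℝ) ^ (1 - 2 * σ)) :=
      (summable_nat_add_iff 1).2 (Real.summable_nat_rpow.2 (by linarith))
    have hS0 : 0 ≤ ∑' i : ℕ, ((i + 1 : ℕ) : ℝ) ^ (1 - 2 * σ) := tsum_nonneg fun i => by positivity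
    obtain ⟨S, hS⟩ : ∃ S : ℝ, S = ∑' i : ℕ, ((i + 1 : ℕ) : ℝ) ^ (1 - 2 * σ) := ⟨_, rfl⟩
    rw [← hS] at hS0
    have hA : 0 < M + S + 1 := by positivity
    refine ⟨(1 + 2 * κ * R) * (M + S + 1) / (c / 2) ^ 2, by positivity, fun k hk =>
      ⟨fun h' => by linarith, fun h' => by linarith, fun _ => ?_⟩⟩
    have h1 := hmain k (M + S + 1) 1 hk hA.le zero_le_one (by linarith) (by
      have := hsum.sum_le_tsum (Finset.range k) (fun i _ => by positivity)
      rw [← hS] at this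
      linarith)
    rwa [one_mul] at h1
end
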